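/- arXiv:2410.16745 — 2 statements merged into one kernel-verified Lean document; each statement's English description precedes it below -/
import Mathlib

section
/- There exist a strict demand lexicographic housing market ≽ with three agents, two distinct strong core allocations a and b of ≽, and an agent i with a ≻ᵢ b; in particular, the strong core of a demand lexicographic market can be multi-valued and need not be essentially single-valued. -/
open Classical Function

/-- A strict linear order on `N`: `pref h h'` means `h` is strictly preferred to `h'`. -/
structure SLO (N : Type*) where
  pref : N → N → Prop
  trichotomous : ∀ a b, pref a b ∨ a = b ∨ pref b a
  irrefl : ∀ a, ¬ pref a a
  trans : ∀ a b c, pref a b → pref b c → pref a c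

/-- A strict demand lexicographic preference: strict demand order over houses and strict
supply order over agents, compared lexicographically demand-first. -/
structure SDemLexPref (N : Type*) where
  dem : SLO N
  sup : SLO N

variable {N : Type*}

/-- `a ≻ᵢ b` for strict demand lexicographic preferences. -/
def SDemLexPref.SPref (P : SDemLexPref N) (i : N) (a b : Equiv.Perm N) : Prop :=
  P.dem.pref (a i) (b i) ∨ (a i = b i ∧ P.sup.pref (a.symm i) (b.symm i))

/-- `a ≽ᵢ b` for strict demand lexicographic preferences (`a ∼ᵢ b` iff the allotments
coincide). -/
def SDemLexPref.WPref (P : SDemLexPref N) (i : N) (a b : Equiv.Perm N) : Prop :=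
  P.SPref i a b ∨ (a i = b i ∧ a.symm i = b.symm i)

section SProps
variable [DecidableEq N]

/-- Coalition `S` weakly blocks allocation `a` at the strict market `P`. -/
def SWeaklyBlocks (P : N → SDemLexPref N) (S : Finset N) (a : Equiv.Perm N) : Prop :=
  S.Nonempty ∧ ∃ b : Equiv.Perm N, S.image ⇑b = S ∧
    (∀ i ∈ S, (P i).WPref i b a) ∧ ∃ j ∈ S, (P j).SPref j b a

/-- `a` is a strong core allocation of the strict market `P`. -/
def SIsStrongCore (P : N → SDemLexPref N) (a : Equiv.Perm N) : Prop :=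
  ∀ S : Finset N, ¬ SWeaklyBlocks P S a

/-- `a` is individually rational at the strict market `P`. -/
def SIndRational (P : N → SDemLexPref N) (a : Equiv.Perm N) : Prop :=
  ∀ i : N, (P i).WPref i a 1

/-- `b` Pareto dominates `a` at the strict market `P`. -/
def SParetoDom (P : N → SDemLexPref N) (b a : Equiv.Perm N) : Prop :=
  (∀ i : N, (P i).WPref i b a) ∧ ∃ j : N, (P j).SPref j b a

/-- `a` is Pareto efficient at the strict market `P`. -/
def SParetoEff (P : N → SDemLexPref N) (a : Equiv.Perm N) : Prop :=
  ¬ ∃ b : Equiv.Perm N, SParetoDom P b a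

/-- `a` is pair efficient at the strict market `P`. -/
def SPairEff (P : N → SDemLexPref N) (a : Equiv.Perm N) : Prop :=
  ¬ ∃ i j : N, i ≠ j ∧ (P i).SPref i (a * Equiv.swap i j) a ∧
    (P j).SPref j (a * Equiv.swap i j) a ∧ SParetoDom P (a * Equiv.swap i j) a

/-- `a` is pairwise stable at the strict market `P`. -/
def SPairwiseStable (P : N → SDemLexPref N) (a : Equiv.Perm N) : Prop :=
  ¬ ∃ i j : N, i ≠ j ∧ (P i).SPref i (a * Equiv.swap i j) a ∧
    (P j).SPref j (a * Equiv.swap i j) a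

/-- `a` is stable at the strict market `P`. -/
def SStable (P : N → SDemLexPref N) (a : Equiv.Perm N) : Prop :=
  ¬ ∃ (b : Equiv.Perm N) (S : Finset N), S.Nonempty ∧ (∀ k ∉ S, b k = a k) ∧
      S.image ⇑b = S.image ⇑a ∧ ∀ i ∈ S, (P i).SPref i b a

end SProps

/-- The strict linear order preferring the elements of lower rank. -/
def SLO.ofRank {n : ℕ} (r : Equiv.Perm (Fin n)) : SLO (Fin n) where
  pref x y := r x < r y
  trichotomous x y := (lt_trichotomy (r x) (r y)).imp_right (Or.imp_left fun h => r.injective h)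
  irrefl x := lt_irrefl (r x)
  trans _ _ _ := lt_trans

/-- Demand orders `1, 0, 2` for agent `0`, `2, 0, 1` for agent `1` and `0, 2, 1` for agent `2`;
every agent has the supply order `0, 1, 2`. -/
def multivaluedMarket (i : Fin 3) : SDemLexPref (Fin 3) where
  dem := SLO.ofRank (![Equiv.swap 0 1, finRotate 3, Equiv.swap 1 2] i)
  sup := SLO.ofRank 1

instance (i j : Fin 3) (a b : Equiv.Perm (Fin 3)) :
    Decidable ((multivaluedMarket i).SPref j a b) :=
  inferInstanceAs (Decidable (_ < _ ∨ (a j = b j ∧ a.symm j < b.symm j)))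

instance (i j : Fin 3) (a b : Equiv.Perm (Fin 3)) :
    Decidable ((multivaluedMarket i).WPref j a b) :=
  inferInstanceAs (Decidable ((multivaluedMarket i).SPref j a b ∨ (a j = b j ∧ a.symm j = b.symm j)))

/-- There is a strict demand lexicographic market with three agents
having two distinct strong core allocations, one of which some agent strictly prefers:
the strong core can be multi-valued and need not be essentially single-valued. -/
theorem strongCore_multivalued :
    ∃ (P : Fin 3 → SDemLexPref (Fin 3)) (a b : Equiv.Perm (Fin 3)) (i : Fin 3),
      a ≠ b ∧ SIsStrongCore P a ∧ SIsStrongCore P b ∧ (P i).SPref i a b := by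
  refine ⟨multivaluedMarket, Equiv.swap 0 1, finRotate 3, 0, by decide, ?_, ?_, by decide⟩ <;>
  · unfold SIsStrongCore SWeaklyBlocks
    decide +kernel
end

section
/- The domain of strict demand lexicographic preferences is not rich in the sense of Sönmez: there exist a three-agent setting, an agent i, a strict demand lexicographic preference ≽ᵢ for i, and an allotment x ∈ A_i with x ≻ᵢ (i,i), such that no strict demand lexicographic preference ≽̃ᵢ for i satisfies all three conditions: (i) for every y ∈ A_i, y ≽ᵢ x iff y ≽̃ᵢ x; (ii) for every y ∈ A_i, x ≽ᵢ y iff x ≽̃ᵢ y; and (iii) for every y ∈ A_i, if x ≻ᵢ y then x ≻̃ᵢ (i,i) and (i,i) ≽̃ᵢ y. -/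
open Classical Function

/-- The set of possible allotments of agent `i`: either both coordinates differ from `i`
(agent `i` receives house `x.1` and agent `x.2` receives `i`'s house) or `x = (i, i)`. -/
def Allot {N : Type*} (i : N) : Set (N × N) := {x | (x.1 ≠ i ∧ x.2 ≠ i) ∨ x = (i, i)}

variable {N : Type*}

/-- `x ≻ᵢ y` on allotments, for a strict demand lexicographic preference. -/
def SDemLexPref.APref (P : SDemLexPref N) (x y : N × N) : Prop :=
  P.dem.pref x.1 y.1 ∨ (x.1 = y.1 ∧ P.sup.pref x.2 y.2)

/-- `x ≽ᵢ y` on allotments, for a strict demand lexicographic preference. -/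
def SDemLexPref.AWPref (P : SDemLexPref N) (x y : N × N) : Prop :=
  P.APref x y ∨ x = y

/-- The strict order `<` of a linear order: smaller elements are preferred. -/
def SLO.ofLT (α : Type*) [LinearOrder α] : SLO α where
  pref a b := a < b
  trichotomous := lt_trichotomy
  irrefl := lt_irrefl
  trans _ _ _ := lt_trans

/-- The endowment allotment never separates two allotments with the same received house
`h ≠ i`. -/
theorem SDemLexPref.not_awPref_endowment_of_aPref_endowment (P : SDemLexPref N) {i h j k : N}
    (hi : h ≠ i) (hx : P.APref (h, j) (i, i)) : ¬ P.AWPref (i, i) (h, k) := by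
  have hd : P.dem.pref h i := hx.resolve_right fun e => hi e.1
  rintro ((hy | ⟨e, -⟩) | e)
  · exact P.dem.irrefl h (P.dem.trans h i h hd hy)
  · exact hi e.symm
  · exact hi (congrArg Prod.fst e).symm

/-- The domain of strict demand lexicographic preferences is not rich in
the sense of Sönmez: in a three-agent setting there are an agent `i`, a strict demand
lexicographic preference and an allotment `x ≻ᵢ (i,i)` such that no strict demand
lexicographic preference keeps the weak upper and lower contour sets at `x` while ranking
the endowment allotment `(i,i)` immediately after `x`. -/
theorem strict_demLex_domain_not_rich :
    ∃ (i : Fin 3) (P : SDemLexPref (Fin 3)) (x : Fin 3 × Fin 3),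
      x ∈ Allot i ∧ P.APref x (i, i) ∧
      ¬ ∃ P' : SDemLexPref (Fin 3),
          (∀ y ∈ Allot i, (P.AWPref y x ↔ P'.AWPref y x)) ∧
          (∀ y ∈ Allot i, (P.AWPref x y ↔ P'.AWPref x y)) ∧
          (∀ y ∈ Allot i, P.APref x y → P'.APref x (i, i) ∧ P'.AWPref (i, i) y) := by
  refine ⟨2, ⟨SLO.ofLT _, SLO.ofLT _⟩, (0, 0), Or.inl ⟨by decide, by decide⟩,
    Or.inl (show (0 : Fin 3) < 2 by decide), ?_⟩
  rintro ⟨P', -, -, hP'⟩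
  obtain ⟨hx, hy⟩ := hP' (0, 1) (Or.inl ⟨by decide, by decide⟩)
    (Or.inr ⟨rfl, show (0 : Fin 3) < 1 by decide⟩)
  exact P'.not_awPref_endowment_of_aPref_endowment (by decide) hx hy
end
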